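/- Let C ⊂ Gr(2,V) be an irreducible curve of degree d ≥ 3, not contained in any plane σ₂(p₀), and let S ⊂ ℙ(V) be the union of the lines w̄ with w̄ ∈ C. If S is not a cone, a plane or a quadric surface, then the smallest projective subspace P(C) of ℙ(Λ²V) containing C has dimension at least 3. -/

import Mathlib

namespace RQS

open MvPolynomial


open MvPolynomial

variable (K : Type) [Field K]

/-- Projective n-space modelled as the projectivization of `Fin n → K`
(so `PP K (n+1)` is ℙⁿ). -/
abbrev PP (n : ℕ) : Type := Projectivization K (Fin n → K)

variable {K}

/-- Vanishing of a (homogeneous) polynomial at a projective point. -/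
def vanishes {n : ℕ} (p : MvPolynomial (Fin n) K) (x : PP K n) : Prop :=
  ∀ (v : Fin n → K) (h : v ≠ 0), Projectivization.mk K v h = x → eval v p = 0

/-- Projective zero locus of a set of polynomials. -/
def zeroLocus {n : ℕ} (S : Set (MvPolynomial (Fin n) K)) : Set (PP K n) :=
  {x | ∀ p ∈ S, vanishes p x}

/-- Zariski closed subsets of projective space. -/
def ZClosed {n : ℕ} (X : Set (PP K n)) : Prop :=
  ∃ S : Set (MvPolynomial (Fin n) K), (∀ p ∈ S, ∃ d, p.IsHomogeneous d) ∧ X = zeroLocus S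

/-- Irreducibility with respect to the Zariski topology. -/
def ZIrred {n : ℕ} (X : Set (PP K n)) : Prop :=
  X.Nonempty ∧ ∀ A B : Set (PP K n), ZClosed A → ZClosed B → X ⊆ A ∪ B → X ⊆ A ∨ X ⊆ B

/-- `X` contains a chain of closed irreducible subsets of length `d+1`. -/
def dimGE {n : ℕ} (X : Set (PP K n)) (d : ℕ) : Prop :=
  ∃ f : Fin (d + 1) → Set (PP K n),
    (∀ i, ZClosed (f i) ∧ ZIrred (f i) ∧ f i ⊆ X) ∧ StrictMono f

/-- `X` has (Krull) dimension exactly `d`. -/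
def HasDim {n : ℕ} (X : Set (PP K n)) (d : ℕ) : Prop := dimGE X d ∧ ¬ dimGE X (d + 1)

/-- The hyperplane with coefficient vector `φ`. -/
def hyp {n : ℕ} (φ : Fin n → K) : Set (PP K n) :=
  {x | ∀ (v : Fin n → K) (h : v ≠ 0), Projectivization.mk K v h = x → ∑ i, φ i * v i = 0}

/-- Degree of a (reduced) curve: every hyperplane not containing it meets it in at most `d`
points, and some hyperplane meets it in exactly `d` points. -/
def HasCurveDeg {n : ℕ} (X : Set (PP K n)) (d : ℕ) : Prop :=
  (∀ φ : Fin n → K, φ ≠ 0 → ¬ X ⊆ hyp φ →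
    (X ∩ hyp φ).Finite ∧ (X ∩ hyp φ).ncard ≤ d) ∧
  (∃ φ : Fin n → K, φ ≠ 0 ∧ ¬ X ⊆ hyp φ ∧ (X ∩ hyp φ).ncard = d)

/-- An irreducible projective curve of degree `d`. -/
def IsCurveOfDeg {n : ℕ} (X : Set (PP K n)) (d : ℕ) : Prop :=
  ZClosed X ∧ ZIrred X ∧ HasDim X 1 ∧ HasCurveDeg X d

/-- A property holds at a general point of `S`. -/
def GenericPts {n : ℕ} (S : Set (PP K n)) (Q : PP K n → Prop) : Prop :=
  ∃ T : Set (PP K n), ZClosed T ∧ ¬ S ⊆ T ∧ ∀ p ∈ S, p ∉ T → Q p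

/-! ### Plücker coordinates: `p₁₂,p₁₃,p₁₄,p₂₃,p₂₄,p₃₄` indexed by `0,…,5` -/

/-- Plücker coordinates of the line through `u` and `v`, i.e. the bivector `u ∧ v`. -/
def plucker (u v : Fin 4 → K) : Fin 6 → K :=
  ![u 0 * v 1 - u 1 * v 0, u 0 * v 2 - u 2 * v 0, u 0 * v 3 - u 3 * v 0,
    u 1 * v 2 - u 2 * v 1, u 1 * v 3 - u 3 * v 1, u 2 * v 3 - u 3 * v 2]

/-- The Plücker quadric `p₁₂p₃₄ - p₁₃p₂₄ + p₁₄p₂₃`, i.e. `½ w ∧ w`. -/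
def plQuad (w : Fin 6 → K) : K := w 0 * w 5 - w 1 * w 4 + w 2 * w 3

/-- The wedge pairing `w ∧ z ∈ Λ⁴V ≅ K` of two bivectors. -/
def plPair (w z : Fin 6 → K) : K :=
  w 0 * z 5 + w 5 * z 0 - w 1 * z 4 - w 4 * z 1 + w 2 * z 3 + w 3 * z 2

/-- The wedge `w ∧ v ∈ Λ³V ≅ V*` of a bivector `w` with a vector `v`;
`w ∧ v = 0` expresses that the point `v̄` lies on the line `w̄`. -/
def wedgePt (w : Fin 6 → K) (v : Fin 4 → K) : Fin 4 → K :=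
  ![w 0 * v 2 - w 1 * v 1 + w 3 * v 0,
    w 0 * v 3 - w 2 * v 1 + w 4 * v 0,
    w 1 * v 3 - w 2 * v 2 + w 5 * v 0,
    w 3 * v 3 - w 4 * v 2 + w 5 * v 1]

/-- The set of points of ℙ³ on the line with Plücker vector `w`. -/
def lineOfRep (w : Fin 6 → K) : Set (PP K 4) :=
  {p | ∀ (v : Fin 4 → K) (h : v ≠ 0), Projectivization.mk K v h = p → wedgePt w v = 0}

/-- `w` represents a line of ℙ³: it is nonzero and decomposable. -/
def IsLineRep (w : Fin 6 → K) : Prop := w ≠ 0 ∧ plQuad w = 0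

variable (K) in
/-- The Grassmannian `Gr(2,4) ⊂ ℙ⁵` of lines in ℙ³. -/
def grass : Set (PP K 6) :=
  {x | ∃ (w : Fin 6 → K) (h : w ≠ 0), Projectivization.mk K w h = x ∧ plQuad w = 0}

/-- The line in ℙ³ corresponding to a point `x` of the Grassmannian. -/
def lineOf (x : PP K 6) : Set (PP K 4) :=
  {p | ∀ (w : Fin 6 → K) (h : w ≠ 0), Projectivization.mk K w h = x → p ∈ lineOfRep w}

/-- The set of (Grassmann points of) lines contained in a surface `S ⊂ ℙ³`. -/
def linesOf (S : Set (PP K 4)) : Set (PP K 6) :=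
  {x | x ∈ grass K ∧ lineOf x ⊆ S}

/-- A ruled surface: an irreducible closed surface which is a union of lines. -/
def IsRuled (S : Set (PP K 4)) : Prop :=
  ZClosed S ∧ ZIrred S ∧ HasDim S 2 ∧ ∀ p ∈ S, ∃ x ∈ linesOf S, p ∈ lineOf x

/-- Degree of a surface in ℙ³ via intersections with lines. -/
def HasSurfDeg (S : Set (PP K 4)) (d : ℕ) : Prop :=
  (∀ w : Fin 6 → K, IsLineRep w → ¬ lineOfRep w ⊆ S →
    (S ∩ lineOfRep w).Finite ∧ (S ∩ lineOfRep w).ncard ≤ d) ∧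
  (∃ w : Fin 6 → K, IsLineRep w ∧ ¬ lineOfRep w ⊆ S ∧ (S ∩ lineOfRep w).ncard = d)

/-- A cone: all lines of `S` pass through a common point. -/
def IsCone (S : Set (PP K 4)) : Prop :=
  ∃ p : PP K 4, ∀ x ∈ linesOf S, p ∈ lineOf x

/-- `σ₂(p₀)`: the 2-plane in the Grassmannian of all lines through `p₀`. -/
def sigma2 (p₀ : PP K 4) : Set (PP K 6) := {x | x ∈ grass K ∧ p₀ ∈ lineOf x}

/-- The projective tangent space `T_{Gr,x₀}` of the Plücker quadric at `x₀`,
namely the hyperplane `{z̄ : w₀ ∧ z = 0}`. -/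
def tangentGr (x₀ : PP K 6) : Set (PP K 6) :=
  {x | ∀ (w : Fin 6 → K) (h : w ≠ 0), Projectivization.mk K w h = x →
    ∀ (w₀ : Fin 6 → K) (h₀ : w₀ ≠ 0), Projectivization.mk K w₀ h₀ = x₀ → plPair w₀ w = 0}

/-- The linear span of (the representatives of) a subset of projective space. -/
def spanOfSet {n : ℕ} (X : Set (PP K n)) : Submodule K (Fin n → K) :=
  Submodule.span K {v | ∃ h : v ≠ 0, Projectivization.mk K v h ∈ X}

/-- The projective subspace associated to a linear subspace. -/
def projSub {n : ℕ} (U : Submodule K (Fin n → K)) : Set (PP K n) :=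
  {x | ∀ (v : Fin n → K) (h : v ≠ 0), Projectivization.mk K v h = x → v ∈ U}

/-- `P(C)`: the smallest projective subspace containing `C`. -/
def projSpanOf {n : ℕ} (X : Set (PP K n)) : Set (PP K n) := projSub (spanOfSet X)

/-! ### Smoothness via Jacobian criteria -/

/-- The homogeneous polynomials vanishing on `X`. -/
def homIdeal {n : ℕ} (X : Set (PP K n)) : Set (MvPolynomial (Fin n) K) :=
  {p | (∃ d, p.IsHomogeneous d) ∧ ∀ x ∈ X, vanishes p x}

/-- The span of the gradients at `v` of all homogeneous polynomials vanishing on `X`. -/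
def gradSpan {n : ℕ} (X : Set (PP K n)) (v : Fin n → K) : Submodule K (Fin n → K) :=
  Submodule.span K
    {g | ∃ p ∈ homIdeal X, g = fun i => eval v (pderiv i p)}

/-- Smooth point of a projective *curve* `X ⊂ ℙ(Kⁿ)` (Jacobian criterion:
the affine cone over `X` has a 2-dimensional tangent space there). -/
def CurveSmoothPt {n : ℕ} (X : Set (PP K n)) (x : PP K n) : Prop :=
  ∀ (v : Fin n → K) (h : v ≠ 0), Projectivization.mk K v h = x →
    Module.finrank K (gradSpan X v) = n - 2

/-- Smooth point of a *surface* `S ⊂ ℙ³` (Jacobian criterion). -/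
def SurfSmoothPt (S : Set (PP K 4)) (x : PP K 4) : Prop :=
  ∀ (v : Fin 4 → K) (h : v ≠ 0), Projectivization.mk K v h = x →
    Module.finrank K (gradSpan S v) = 1

/-- The singular locus of a surface `S ⊂ ℙ³`. -/
def singLocus (S : Set (PP K 4)) : Set (PP K 4) := {x ∈ S | ¬ SurfSmoothPt S x}


/-! ### Zariski closed sets -/

section ZariskiClosed

variable {n : ℕ}

theorem eval_smul_of_isHomogeneous {p : MvPolynomial (Fin n) K} {d : ℕ} (hp : p.IsHomogeneous d)
    (a : K) (v : Fin n → K) : eval (a • v) p = a ^ d * eval v p := by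
  rw [eval_eq, eval_eq, Finset.mul_sum]
  refine Finset.sum_congr rfl fun m hm => ?_
  have hdeg : d = ∑ i, m i := by
    rw [hp.degree_eq_sum_deg_support hm]
    exact Finset.sum_subset (Finset.subset_univ _) fun i _ hi => by simpa using hi
  rw [hdeg, ← Finset.prod_pow_eq_pow_sum, mul_left_comm]
  have hpow : ∀ x : Fin n → K, ∏ i ∈ m.support, x i ^ m i = ∏ i, x i ^ m i := fun x =>
    Finset.prod_subset (Finset.subset_univ _) fun i _ hi => by
      rw [Finsupp.notMem_support_iff.1 hi, pow_zero]
  rw [hpow, hpow, ← Finset.prod_mul_distrib]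
  simp [mul_pow]

theorem vanishes_mk_iff {p : MvPolynomial (Fin n) K} {d : ℕ} (hp : p.IsHomogeneous d)
    {v : Fin n → K} (hv : v ≠ 0) :
    vanishes p (Projectivization.mk K v hv) ↔ eval v p = 0 := by
  refine ⟨fun h => h v hv rfl, fun h w hw hwv => ?_⟩
  obtain ⟨a, rfl⟩ := (Projectivization.mk_eq_mk_iff' K w v hw hv).1 hwv
  rw [eval_smul_of_isHomogeneous hp, h, mul_zero]

theorem ZClosed.union {A B : Set (PP K n)} (hA : ZClosed A) (hB : ZClosed B) :
    ZClosed (A ∪ B) := by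
  obtain ⟨S, hS, rfl⟩ := hA
  obtain ⟨T, hT, rfl⟩ := hB
  refine ⟨{r | ∃ p ∈ S, ∃ q ∈ T, r = p * q}, ?_, ?_⟩
  · rintro _ ⟨p, hp, q, hq, rfl⟩
    obtain ⟨d, hd⟩ := hS p hp
    obtain ⟨e, he⟩ := hT q hq
    exact ⟨d + e, hd.mul he⟩
  · ext x
    induction x using Projectivization.ind with
    | h v hv =>
      constructor
      · rintro (h | h) _ ⟨p, hp, q, hq, rfl⟩ w hw hwv
        · rw [map_mul, h p hp w hw hwv, zero_mul]
        · rw [map_mul, h q hq w hw hwv, mul_zero]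
      · intro h
        by_contra hcon
        simp only [Set.mem_union, not_or, zeroLocus, Set.mem_ofPred_eq, not_forall] at hcon
        obtain ⟨⟨p, hp, hpv⟩, q, hq, hqv⟩ := hcon
        obtain ⟨d, hd⟩ := hS p hp
        obtain ⟨e, he⟩ := hT q hq
        rw [vanishes_mk_iff hd] at hpv
        rw [vanishes_mk_iff he] at hqv
        have hpq := h (p * q) ⟨p, hp, q, hq, rfl⟩ v hv rfl
        rw [map_mul] at hpq
        exact mul_ne_zero hpv hqv hpq

theorem zClosed_empty : ZClosed (∅ : Set (PP K n)) := by
  refine ⟨{1}, fun p hp => ⟨0, ?_⟩, ?_⟩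
  · rw [Set.mem_singleton_iff.1 hp]
    exact isHomogeneous_one _ _
  · ext x
    induction x using Projectivization.ind with
    | h v hv =>
      simp only [Set.mem_empty_iff_false, false_iff]
      exact fun h => one_ne_zero ((map_one (eval v)).symm.trans (h 1 rfl v hv rfl))

theorem zClosed_singleton (x : PP K n) : ZClosed {x} := by
  induction x using Projectivization.ind with
  | h v hv =>
    refine ⟨{p | ∃ i j, p = C (v i) * X j - C (v j) * X i}, ?_, ?_⟩
    · rintro _ ⟨i, j, rfl⟩
      exact ⟨1, (isHomogeneous_C_mul_X _ _).sub (isHomogeneous_C_mul_X _ _)⟩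
    · ext y
      constructor
      · rintro rfl _ ⟨i, j, rfl⟩ w hw hwv
        obtain ⟨a, rfl⟩ := (Projectivization.mk_eq_mk_iff' K w v hw hv).1 hwv
        simp
        ring
      · induction y using Projectivization.ind with
        | h w hw =>
          intro h
          obtain ⟨i, hi⟩ := Function.ne_iff.1 hv
          have hi : v i ≠ 0 := hi
          refine (Projectivization.mk_eq_mk_iff' K w v hw hv).2 ⟨w i / v i, funext fun j => ?_⟩
          have hij := h _ ⟨i, j, rfl⟩ w hw rfl
          simp only [map_sub, map_mul, eval_C, eval_X] at hij
          simp only [Pi.smul_apply, smul_eq_mul]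
          field_simp
          linear_combination -hij

theorem zClosed_of_finite {A : Set (PP K n)} (hA : A.Finite) : ZClosed A := by
  induction A, hA using Set.Finite.induction_on with
  | empty => exact zClosed_empty
  | @insert x s _ _ hs => exact Set.insert_eq x s ▸ (zClosed_singleton x).union hs

/-- A finite irreducible set has at most one point. -/
theorem ZIrred.subsingleton_of_finite {A : Set (PP K n)} (hA : ZIrred A) (hfin : A.Finite) :
    A.Subsingleton := by
  obtain ⟨x, hx⟩ := hA.1
  rcases hA.2 {x} (A \ {x}) (zClosed_singleton x) (zClosed_of_finite hfin.sdiff)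
    (by rw [Set.union_sdiff_self]; exact Set.subset_union_right) with h | h
  · exact Set.subsingleton_singleton.anti h
  · exact absurd rfl (h hx).2

/-- The linear form with coefficient vector `φ`. -/
noncomputable def linForm (φ : Fin n → K) : MvPolynomial (Fin n) K := ∑ i, C (φ i) * X i

theorem isHomogeneous_linForm (φ : Fin n → K) : (linForm φ).IsHomogeneous 1 :=
  IsHomogeneous.sum _ _ _ fun _ _ => isHomogeneous_C_mul_X _ _

theorem eval_linForm (φ v : Fin n → K) : eval v (linForm φ) = ∑ i, φ i * v i := by
  simp [linForm]

theorem mk_mem_hyp_iff {φ v : Fin n → K} (hv : v ≠ 0) :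
    Projectivization.mk K v hv ∈ hyp φ ↔ ∑ i, φ i * v i = 0 := by
  rw [← eval_linForm, ← vanishes_mk_iff (isHomogeneous_linForm φ) hv]
  simp only [hyp, vanishes, eval_linForm, Set.mem_ofPred_eq]

theorem zClosed_hyp (φ : Fin n → K) : ZClosed (hyp φ) := by
  refine ⟨{linForm φ}, fun p hp => ⟨1, hp ▸ isHomogeneous_linForm φ⟩, ?_⟩
  ext x
  simp [hyp, zeroLocus, vanishes, eval_linForm]

end ZariskiClosed

/-! ### Infinite closed sets meet every hyperplane -/

section HyperplaneSection

variable {n : ℕ}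

theorem homogeneousComponent_succ_mul {l : MvPolynomial (Fin n) K} (hl : l.IsHomogeneous 1)
    (b : MvPolynomial (Fin n) K) (m : ℕ) :
    homogeneousComponent (m + 1) (b * l) = homogeneousComponent m b * l := by
  conv_lhs => rw [← sum_homogeneousComponent b, Finset.sum_mul, map_sum]
  have hcomp : ∀ i, homogeneousComponent (m + 1) (homogeneousComponent i b * l) =
      if m = i then homogeneousComponent i b * l else 0 := fun i => by
    rw [homogeneousComponent_of_mem ((homogeneousComponent_isHomogeneous i b).mul hl)]
    simp
  simp only [hcomp, Finset.sum_ite_eq]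
  split_ifs with h
  · rfl
  · rw [homogeneousComponent_eq_zero m b (by simpa using h), zero_mul]

/-- Restriction of polynomials to functions on a set of vectors. -/
noncomputable def restrictTo (Y : Set (Fin n → K)) :
    MvPolynomial (Fin n) K →ₐ[K] (Y → K) :=
  aeval fun i y => y.1 i

theorem restrictTo_apply (Y : Set (Fin n → K)) (p : MvPolynomial (Fin n) K) (y : Y) :
    restrictTo Y p y = eval y.1 p := by
  induction p using MvPolynomial.induction_on with
  | C a => simp [restrictTo]
  | add p q hp hq => simp [hp, hq]
  | mul_X p i hp =>
    rw [map_mul, map_mul, Pi.mul_apply, hp]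
    simp [restrictTo]

/-- If on `Y` a linear form is identically `1` and forms of large degree agree with forms of
degree one less, then `Y` is finite. -/
theorem finite_of_forms_reduce {Y : Set (Fin n → K)} {l : MvPolynomial (Fin n) K}
    (hl : l.IsHomogeneous 1) (hlY : ∀ y ∈ Y, eval y l = 1) (D : ℕ)
    (hred : ∀ m, D ≤ m → ∀ p : MvPolynomial (Fin n) K, p.IsHomogeneous (m + 1) →
      ∃ q : MvPolynomial (Fin n) K, q.IsHomogeneous m ∧ ∀ y ∈ Y, eval y p = eval y q) :
    Y.Finite := by
  let F : ℕ → Submodule K (Y → K) := fun m =>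
    (homogeneousSubmodule (Fin n) K m).map (restrictTo Y).toLinearMap
  have hmono : Monotone F := by
    refine monotone_nat_of_le_succ fun m => ?_
    rintro _ ⟨p, hp, rfl⟩
    refine ⟨p * l, IsHomogeneous.mul hp hl, funext fun y => ?_⟩
    simp [restrictTo_apply, hlY y.1 y.2]
  have hstab : ∀ m, D ≤ m → F m ≤ F D := by
    intro m hm
    induction m, hm using Nat.le_induction with
    | base => exact le_rfl
    | succ m hm ih =>
      refine le_trans ?_ ih
      rintro _ ⟨p, hp, rfl⟩
      obtain ⟨q, hq, hpq⟩ := hred m hm p hp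
      refine ⟨q, hq, funext fun y => ?_⟩
      simp [restrictTo_apply, hpq y.1 y.2]
  have hall : ∀ m, F m ≤ F D := fun m =>
    (hmono (le_max_left m D)).trans (hstab _ (le_max_right m D))
  have hrange : Subalgebra.toSubmodule (restrictTo Y).range ≤ F D := by
    rintro _ ⟨p, rfl⟩
    change restrictTo Y p ∈ F D
    rw [← sum_homogeneousComponent p, map_sum]
    exact Submodule.sum_mem _ fun i _ =>
      hall i ⟨_, homogeneousComponent_isHomogeneous i p, rfl⟩
  have hfg : (Subalgebra.toSubmodule (restrictTo Y).range).FG :=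
    Submodule.FG.of_le ((homogeneousSubmodule_fg _ _ D).map _) hrange
  have hcoord : ∀ i, ((fun y : Fin n → K => y i) '' Y).Finite := by
    intro i
    obtain ⟨P, hP, hPx⟩ := IsIntegral.of_mem_of_fg _ hfg (restrictTo Y (X i)) ⟨X i, rfl⟩
    refine (P.rootSet_finite K).subset ?_
    rintro _ ⟨y, hy, rfl⟩
    rw [Polynomial.mem_rootSet]
    refine ⟨hP.ne_zero, ?_⟩
    have h := congrFun hPx ⟨y, hy⟩
    have h2 := Polynomial.aeval_algHom_apply (Pi.evalAlgHom K (fun _ : Y => K) ⟨y, hy⟩)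
      (restrictTo Y (X i)) P
    simp only [Pi.evalAlgHom_apply, restrictTo_apply, eval_X] at h2
    rw [h2]
    exact h
  refine (Set.Finite.pi hcoord).subset fun y hy => ?_
  simp only [Set.mem_pi]
  exact fun i _ => ⟨y, hy, rfl⟩

/-- A projective closed set disjoint from a hyperplane is finite. -/
theorem exists_mem_hyp_of_infinite [IsAlgClosed K] {A : Set (PP K n)} (hA : ZClosed A)
    (hinf : A.Infinite) (φ : Fin n → K) : (A ∩ hyp φ).Nonempty := by
  by_contra hempty
  rw [Set.not_nonempty_iff_eq_empty] at hempty
  obtain ⟨T, hT, rfl⟩ := hA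
  let I : Ideal (MvPolynomial (Fin n) K) := Ideal.span T
  let J : Ideal (MvPolynomial (Fin n) K) := I ⊔ Ideal.span {linForm φ}
  have hzero : ∀ v ∈ MvPolynomial.zeroLocus K J, v = 0 := by
    intro v hv
    by_contra hv0
    have hmem : Projectivization.mk K v hv0 ∈ zeroLocus T ∩ hyp φ := by
      refine ⟨fun p hp => ?_, ?_⟩
      · obtain ⟨d, hd⟩ := hT p hp
        rw [vanishes_mk_iff hd]
        exact hv p (Ideal.mem_sup_left (Ideal.subset_span hp))
      · rw [mk_mem_hyp_iff, ← eval_linForm]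
        exact hv _ (Ideal.mem_sup_right (Ideal.subset_span rfl))
    rw [hempty] at hmem
    exact hmem
  have hrad : idealOfVars (Fin n) K ≤ J.radical := by
    rw [← vanishingIdeal_zeroLocus_eq_radical (K := K), idealOfVars, Ideal.span_le]
    rintro _ ⟨i, rfl⟩ v hv
    rw [hzero v hv]
    simp
  obtain ⟨D, hD⟩ := Ideal.exists_pow_le_of_le_radical_of_fg hrad (idealOfVars_fg _ _)
  let := gradedAlgebra (σ := Fin n) (R := K)
  have hIhom : I.IsHomogeneous (homogeneousSubmodule (Fin n) K) :=
    Ideal.homogeneous_span _ _ fun p hp => hT p hp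
  let Y : Set (Fin n → K) :=
    {v | ∃ hv : v ≠ 0, Projectivization.mk K v hv ∈ zeroLocus T ∧ eval v (linForm φ) = 1}
  have hIY : ∀ p ∈ I, ∀ y ∈ Y, eval y p = 0 := by
    rintro p hp y ⟨hy, hyT, -⟩
    have hle : I ≤ RingHom.ker (eval y) :=
      Ideal.span_le.2 fun q hq => hyT q hq y hy rfl
    exact hle hp
  have hYfin : Y.Finite := by
    refine finite_of_forms_reduce (isHomogeneous_linForm φ) (fun y hy => hy.2.2) D ?_
    intro m hm p hp
    have hpJ : p ∈ J := by
      refine hD ((mem_pow_idealOfVars_iff _ _).2 fun x hx => ?_)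
      rw [Finsupp.degree_eq_sum]
      have := hp.degree_eq_sum_deg_support hx
      rw [Finset.sum_subset (Finset.subset_univ _) fun i _ hi => by simpa using hi] at this
      omega
    obtain ⟨s, hs, t, ht, rfl⟩ := Submodule.mem_sup.1 hpJ
    obtain ⟨b, rfl⟩ := Ideal.mem_span_singleton'.1 ht
    refine ⟨homogeneousComponent m b, homogeneousComponent_isHomogeneous m b, fun y hy => ?_⟩
    rw [← homogeneousComponent_eq_self hp, map_add,
      homogeneousComponent_succ_mul (isHomogeneous_linForm φ), map_add, map_mul, hy.2.2, mul_one,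
      hIY _ (homogeneousComponent_mem_of_mem hIhom hs _) y hy, zero_add]
  refine hinf ((hYfin.biUnion' (t := fun y hy => {Projectivization.mk K y hy.1})
    fun _ _ => Set.finite_singleton _).subset fun x hx => ?_)
  induction x using Projectivization.ind with
  | h v hv =>
    have hφv : eval v (linForm φ) ≠ 0 := by
      intro h
      rw [eval_linForm, ← mk_mem_hyp_iff hv] at h
      exact Set.eq_empty_iff_forall_notMem.1 hempty _ ⟨hx, h⟩
    have hv' : (eval v (linForm φ))⁻¹ • v ≠ 0 := smul_ne_zero (inv_ne_zero hφv) hv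
    have hmk : Projectivization.mk K _ hv' = Projectivization.mk K v hv :=
      (Projectivization.mk_eq_mk_iff' K _ _ _ _).2 ⟨_, rfl⟩
    simp only [Set.mem_iUnion, Set.mem_singleton_iff]
    refine ⟨_, ⟨hv', hmk ▸ hx, ?_⟩, hmk.symm⟩
    rw [eval_smul_of_isHomogeneous (isHomogeneous_linForm φ), pow_one, inv_mul_cancel₀ hφv]

end HyperplaneSection

/-! ### Incidence of points, lines and planes in Plücker coordinates -/

section Plucker

/-- The plane spanned by the line `u` and the point `v`, as a covector: the components of `u ∧ v`
under the identification `Λ³V ≅ V*`. -/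
def join (u : Fin 6 → K) (v : Fin 4 → K) : Fin 4 → K :=
  ![-(u 3 * v 3 - u 4 * v 2 + u 5 * v 1), u 1 * v 3 - u 2 * v 2 + u 5 * v 0,
    -(u 0 * v 3 - u 2 * v 1 + u 4 * v 0), u 0 * v 2 - u 1 * v 1 + u 3 * v 0]

/-- Dual Plücker coordinates. -/
def dualLine (u : Fin 6 → K) : Fin 6 → K := ![u 5, -u 4, u 3, u 2, -u 1, u 0]

/-- The intersection point of the line `u` and the plane `ψ`; it vanishes iff the line lies in the
plane. -/
def meet (u : Fin 6 → K) (ψ : Fin 4 → K) : Fin 4 → K := join (dualLine u) ψ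

theorem join_eq_zero_iff {u : Fin 6 → K} {v : Fin 4 → K} : join u v = 0 ↔ wedgePt u v = 0 := by
  simp only [funext_iff, Fin.forall_fin_succ, join, wedgePt]
  simp
  grind

theorem join_add_left (u u' : Fin 6 → K) (v : Fin 4 → K) :
    join (u + u') v = join u v + join u' v := by
  ext i
  fin_cases i <;> simp [join] <;> ring

theorem join_smul_left (a : K) (u : Fin 6 → K) (v : Fin 4 → K) :
    join (a • u) v = a • join u v := by
  ext i
  fin_cases i <;> simp [join] <;> ring

theorem meet_join_self (u : Fin 6 → K) (v : Fin 4 → K) :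
    meet u (join u v) = -plQuad u • v := by
  ext i
  fin_cases i <;> simp [meet, dualLine, join, plQuad] <;> ring

theorem join_meet_self (u : Fin 6 → K) (ψ : Fin 4 → K) :
    join u (meet u ψ) = -plQuad u • ψ := by
  ext i
  fin_cases i <;> simp [meet, dualLine, join, plQuad] <;> ring

theorem meet_join_add (u w : Fin 6 → K) (v : Fin 4 → K) :
    meet u (join w v) + meet w (join u v) = -plPair u w • v := by
  ext i
  fin_cases i <;> simp [meet, dualLine, join, plPair] <;> ring

theorem join_meet_add (u w : Fin 6 → K) (ψ : Fin 4 → K) :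
    join u (meet w ψ) + join w (meet u ψ) = -plPair u w • ψ := by
  ext i
  fin_cases i <;> simp [meet, dualLine, join, plPair] <;> ring

theorem sum_join_mul (u : Fin 6 → K) (v y : Fin 4 → K) :
    ∑ i, join u v i * y i = -∑ i, v i * join u y i := by
  simp [join, Fin.sum_univ_succ]
  ring

theorem sum_meet_mul (u : Fin 6 → K) (ψ χ : Fin 4 → K) :
    ∑ i, meet u ψ i * χ i = -∑ i, ψ i * meet u χ i :=
  sum_join_mul _ _ _

theorem join_mul_sub (u : Fin 6 → K) (v ψ : Fin 4 → K) :
    join u v 0 * ψ 1 - join u v 1 * ψ 0 =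
      -u 5 * (∑ i, ψ i * v i) - (meet u ψ 2 * v 3 - meet u ψ 3 * v 2) ∧
    join u v 0 * ψ 2 - join u v 2 * ψ 0 =
      u 4 * (∑ i, ψ i * v i) + (meet u ψ 1 * v 3 - meet u ψ 3 * v 1) ∧
    join u v 0 * ψ 3 - join u v 3 * ψ 0 =
      -u 3 * (∑ i, ψ i * v i) - (meet u ψ 1 * v 2 - meet u ψ 2 * v 1) ∧
    join u v 1 * ψ 2 - join u v 2 * ψ 1 =
      -u 2 * (∑ i, ψ i * v i) - (meet u ψ 0 * v 3 - meet u ψ 3 * v 0) ∧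
    join u v 1 * ψ 3 - join u v 3 * ψ 1 =
      u 1 * (∑ i, ψ i * v i) + (meet u ψ 0 * v 2 - meet u ψ 2 * v 0) ∧
    join u v 2 * ψ 3 - join u v 3 * ψ 2 =
      -u 0 * (∑ i, ψ i * v i) - (meet u ψ 0 * v 1 - meet u ψ 1 * v 0) := by
  simp only [join, meet, dualLine, Fin.sum_univ_four]
  refine ⟨?_, ?_, ?_, ?_, ?_, ?_⟩ <;> simp <;> ring

theorem join_mul_comm_of_mem_plane {u : Fin 6 → K} {v ψ : Fin 4 → K} (hu : meet u ψ = 0)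
    (hv : ∑ i, ψ i * v i = 0) (i j : Fin 4) : join u v i * ψ j = join u v j * ψ i := by
  obtain ⟨h01, h02, h03, h12, h13, h23⟩ := join_mul_sub u v ψ
  simp only [hu, hv, Pi.zero_apply, zero_mul, mul_zero, sub_zero, add_zero, sub_eq_zero] at *
  fin_cases i <;> fin_cases j <;> first | rfl | assumption | (symm; assumption)

theorem mem_plane_of_join_eq_zero {u : Fin 6 → K} {v ψ : Fin 4 → K} (hu0 : u ≠ 0)
    (hu : meet u ψ = 0) (huv : join u v = 0) : ∑ i, ψ i * v i = 0 := by
  by_contra hv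
  obtain ⟨h01, h02, h03, h12, h13, h23⟩ := join_mul_sub u v ψ
  simp only [hu, huv, Pi.zero_apply, zero_mul, sub_zero, add_zero, zero_eq_mul, neg_eq_zero, hv,
    or_false] at *
  exact hu0 (funext fun i => by fin_cases i <;> assumption)

theorem exists_meet_ne_zero {u : Fin 6 → K} (hu : u ≠ 0) : ∃ ψ, meet u ψ ≠ 0 := by
  by_contra! h
  have h0 := h ![1, 0, 0, 0]
  have h1 := h ![0, 1, 0, 0]
  have h2 := h ![0, 0, 1, 0]
  refine hu (funext fun i => ?_)
  simp only [funext_iff, Fin.forall_fin_succ, meet, dualLine, join] at h0 h1 h2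
  fin_cases i <;> simp_all

/-- Two lines whose Plücker vectors pair to zero have a common point. -/
theorem exists_common_point {a b : Fin 6 → K} (ha0 : a ≠ 0) (ha : plQuad a = 0)
    (hb : plQuad b = 0) (hab : plPair a b = 0) :
    ∃ v, v ≠ 0 ∧ join a v = 0 ∧ join b v = 0 := by
  by_cases h : ∀ t, meet a (join b t) = 0
  · obtain ⟨ψ, hψ⟩ := exists_meet_ne_zero ha0
    refine ⟨meet a ψ, hψ, by rw [join_meet_self, ha, neg_zero, zero_smul], funext fun j => ?_⟩
    have hpair := sum_join_mul b (meet a ψ) (Pi.single j 1)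
    rw [sum_meet_mul, h] at hpair
    simpa [Pi.single_apply] using hpair
  · obtain ⟨t, ht⟩ := not_forall.1 h
    refine ⟨meet a (join b t), ht, by rw [join_meet_self, ha, neg_zero, zero_smul], ?_⟩
    have hsum := join_meet_add a b (join b t)
    have hzero : join a 0 = 0 := by ext i; fin_cases i <;> simp [join]
    rwa [meet_join_self, hb, hab, neg_zero, zero_smul, zero_smul, hzero, zero_add] at hsum

/-- Three pairwise incident lines are concurrent or coplanar. -/
theorem concurrent_or_coplanar {a b w : Fin 6 → K} (ha0 : a ≠ 0) (ha : plQuad a = 0)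
    (hb : plQuad b = 0) (hw : plQuad w = 0) (hab : plPair a b = 0) (haw : plPair a w = 0)
    (hbw : plPair b w = 0) :
    (∃ v, v ≠ 0 ∧ join a v = 0 ∧ join b v = 0 ∧ join w v = 0) ∨
      ∃ ψ, ψ ≠ 0 ∧ meet a ψ = 0 ∧ meet b ψ = 0 ∧ meet w ψ = 0 := by
  obtain ⟨v, hv0, hav, hbv⟩ := exists_common_point ha0 ha hb hab
  by_cases hwv : join w v = 0
  · exact Or.inl ⟨v, hv0, hav, hbv, hwv⟩
  have hzero : meet w 0 = 0 := by ext i; fin_cases i <;> simp [meet, join]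
  refine Or.inr ⟨join w v, hwv, ?_, ?_, by rw [meet_join_self, hw, neg_zero, zero_smul]⟩
  · have h := meet_join_add a w v
    rwa [hav, haw, hzero, add_zero, neg_zero, zero_smul] at h
  · have h := meet_join_add b w v
    rwa [hbv, hbw, hzero, add_zero, neg_zero, zero_smul] at h

theorem meet_add_left (u u' : Fin 6 → K) (ψ : Fin 4 → K) :
    meet (u + u') ψ = meet u ψ + meet u' ψ := by
  ext i
  fin_cases i <;> simp [meet, dualLine, join] <;> ring

theorem meet_smul_left (a : K) (u : Fin 6 → K) (ψ : Fin 4 → K) :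
    meet (a • u) ψ = a • meet u ψ := by
  ext i
  fin_cases i <;> simp [meet, dualLine, join] <;> ring

theorem mk_mem_lineOf_iff {u : Fin 6 → K} (hu : u ≠ 0) {v : Fin 4 → K} (hv : v ≠ 0) :
    Projectivization.mk K v hv ∈ lineOf (Projectivization.mk K u hu) ↔ join u v = 0 := by
  constructor
  · exact fun h => join_eq_zero_iff.2 (h u hu rfl v hv rfl)
  · intro h u' hu' huu' v' hv' hvv'
    obtain ⟨a, rfl⟩ := (Projectivization.mk_eq_mk_iff' K u' u hu' hu).1 huu'
    obtain ⟨b, rfl⟩ := (Projectivization.mk_eq_mk_iff' K v' v hv' hv).1 hvv'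
    have hb : join u (b • v) = b • join u v := by
      ext i
      fin_cases i <;> simp [join] <;> ring
    rw [← join_eq_zero_iff, join_smul_left, hb, h, smul_zero, smul_zero]

theorem mk_mem_grass_iff {u : Fin 6 → K} (hu : u ≠ 0) :
    Projectivization.mk K u hu ∈ grass K ↔ plQuad u = 0 := by
  refine ⟨?_, fun h => ⟨u, hu, rfl, h⟩⟩
  rintro ⟨w, hw, hwu, hq⟩
  obtain ⟨a, rfl⟩ := (Projectivization.mk_eq_mk_iff' K u w hu hw).1 hwu.symm
  have : plQuad (a • w) = a ^ 2 * plQuad w := by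
    simp only [plQuad, Pi.smul_apply, smul_eq_mul]
    ring
  rw [this, hq, mul_zero]

/-- The union of the lines of an infinite closed family lying in a plane is the whole plane. -/
theorem iUnion_lineOf_eq_hyp [IsAlgClosed K] {A : Set (PP K 6)} (hA : ZClosed A)
    (hinf : A.Infinite) {ψ : Fin 4 → K} (hψ : ψ ≠ 0)
    (hplane : ∀ (u : Fin 6 → K) (hu : u ≠ 0), Projectivization.mk K u hu ∈ A → meet u ψ = 0) :
    {p | ∃ x ∈ A, p ∈ lineOf x} = hyp ψ := by
  ext p
  induction p using Projectivization.ind with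
  | h v hv =>
    rw [mk_mem_hyp_iff hv]
    constructor
    · rintro ⟨x, hx, hpx⟩
      induction x using Projectivization.ind with
      | h u hu =>
        rw [mk_mem_lineOf_iff] at hpx
        exact mem_plane_of_join_eq_zero hu (hplane u hu hx) hpx
    · intro hψv
      obtain ⟨i, hi⟩ := Function.ne_iff.1 hψ
      have hi : ψ i ≠ 0 := hi
      let joinCoord : (Fin 6 → K) →ₗ[K] K :=
        { toFun := fun u => join u v i
          map_add' := fun u u' => by rw [join_add_left, Pi.add_apply]
          map_smul' := fun a u => by rw [join_smul_left]; rfl }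
      obtain ⟨x, hxA, hx⟩ := exists_mem_hyp_of_infinite hA hinf
        fun k => joinCoord (Pi.single k 1)
      induction x using Projectivization.ind with
      | h u hu =>
        refine ⟨_, hxA, (mk_mem_lineOf_iff hu hv).2 (funext fun j => ?_)⟩
        rw [mk_mem_hyp_iff] at hx
        have hui : join u v i = 0 := by
          refine Eq.trans ?_ hx
          change joinCoord u = _
          rw [joinCoord.pi_apply_eq_sum_univ u]
          refine Finset.sum_congr rfl fun k _ => ?_
          rw [smul_eq_mul, mul_comm]
          congr 2
          ext l
          simp [Pi.single_apply, eq_comm]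
        have hcomm := join_mul_comm_of_mem_plane (hplane u hu hxA) hψv i j
        rw [hui, zero_mul] at hcomm
        exact (mul_eq_zero.1 hcomm.symm).resolve_right hi

theorem exists_plPair_eq_sum (w : Fin 6 → K) :
    ∃ φ : Fin 6 → K, ∀ u, plPair u w = ∑ i, φ i * u i := by
  refine ⟨dualLine w, fun u => ?_⟩
  simp [plPair, dualLine, Fin.sum_univ_succ]
  ring

theorem plQuad_combination (a b w : Fin 6 → K) (x y z : K) :
    plQuad (x • a + y • b + z • w) = x ^ 2 * plQuad a + y ^ 2 * plQuad b + z ^ 2 * plQuad w +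
      x * y * plPair a b + x * z * plPair a w + y * z * plPair b w := by
  simp only [plQuad, plPair, Pi.add_apply, Pi.smul_apply, smul_eq_mul]
  ring

theorem plPair_combination_left (a b w : Fin 6 → K) (x y z : K) :
    plPair (x • a + y • b + z • w) w = x * plPair a w + y * plPair b w + 2 * z * plQuad w := by
  simp only [plQuad, plPair, Pi.add_apply, Pi.smul_apply, smul_eq_mul]
  ring

end Plucker

/-! STATEMENT 1: if `C ⊂ Gr` is an irreducible curve of degree `d ≥ 3`, not contained in
any `σ₂(p₀)`, and the union `S` of its lines is neither a cone, a plane nor a quadric,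
then the smallest projective subspace `P(C)` containing `C` has dimension ≥ 3. -/

theorem statement_1 (K : Type) [Field K] [IsAlgClosed K]
    (C : Set (PP K 6)) (d : ℕ) (hd : 3 ≤ d)
    (hCGr : C ⊆ grass K)
    (hCcl : ZClosed C) (hCirr : ZIrred C) (hCdim : HasDim C 1) (hCdeg : HasCurveDeg C d)
    (hnotsigma : ∀ p₀ : PP K 4, ¬ C ⊆ sigma2 p₀)
    -- `S` is the union of the lines `w̄` with `w̄ ∈ C`:
    (S : Set (PP K 4)) (hS : S = {p | ∃ x ∈ C, p ∈ lineOf x})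
    -- `S` is not a cone:
    (hcone : ¬ IsCone S)
    -- `S` is not a plane:
    (hplane : ∀ φ : Fin 4 → K, φ ≠ 0 → S ≠ hyp φ)
    -- `S` is not a quadric:
    (hquadric : ∀ q : MvPolynomial (Fin 4) K, q ≠ 0 → q.IsHomogeneous 2 →
      S ≠ zeroLocus {q}) :
    -- `dim P(C) ≥ 3`, i.e. the linear span of (representatives of) `C` in `Λ²V ≅ K⁶`
    -- has dimension at least 4:
    4 ≤ Module.finrank K (spanOfSet C) := by
  by_contra! hlt
  obtain ⟨φ, hφ, hCφ, hcard⟩ := hCdeg.2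
  have hfin := (hCdeg.1 φ hφ hCφ).1
  obtain ⟨xa, xb, xc, hxa, hxb, hxc, hab, hac, hbc⟩ :=
    (Set.two_lt_ncard_iff hfin).1 (by omega : 2 < (C ∩ hyp φ).ncard)
  obtain ⟨xw, hxw, hxwφ⟩ := Set.not_subset.1 hCφ
  have hCinf : C.Infinite := fun h =>
    hab (hCirr.subsingleton_of_finite h hxa.1 hxb.1)
  induction xa using Projectivization.ind with | h a ha0 => ?_
  induction xb using Projectivization.ind with | h b hb0 => ?_
  induction xc using Projectivization.ind with | h c hc0 => ?_
  induction xw using Projectivization.ind with | h w hw0 => ?_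
  have hquad : ∀ (u : Fin 6 → K) (hu : u ≠ 0), Projectivization.mk K u hu ∈ C → plQuad u = 0 :=
    fun u hu h => (mk_mem_grass_iff hu).1 (hCGr h)
  have hφa := (mk_mem_hyp_iff ha0).1 hxa.2
  have hφb := (mk_mem_hyp_iff hb0).1 hxb.2
  have hφc := (mk_mem_hyp_iff hc0).1 hxc.2
  rw [mk_mem_hyp_iff] at hxwφ
  have hφlin : ∀ x y z : K, ∑ i, φ i * (x • a + y • b + z • w) i = z * ∑ i, φ i * w i := by
    intro x y z
    have hexp : ∑ i, φ i * (x • a + y • b + z • w) i =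
        x * ∑ i, φ i * a i + y * ∑ i, φ i * b i + z * ∑ i, φ i * w i := by
      simp only [Finset.mul_sum, ← Finset.sum_add_distrib, Pi.add_apply, Pi.smul_apply,
        smul_eq_mul]
      exact Finset.sum_congr rfl fun i _ => by ring
    rw [hexp, hφa, hφb]
    ring
  have hindep : LinearIndependent K ![a, b, w] := by
    rw [Fintype.linearIndependent_iff]
    intro g hg
    have hg : g 0 • a + g 1 • b + g 2 • w = 0 := by simpa [Fin.sum_univ_three] using hg
    have h2 : g 2 = 0 := by
      have h := hφlin (g 0) (g 1) (g 2)
      rw [hg] at h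
      simpa [hxwφ, eq_comm] using h
    rw [h2, zero_smul, add_zero] at hg
    have h0 : g 0 = 0 := by
      by_contra h0
      refine hab ((Projectivization.mk_eq_mk_iff' K a b ha0 hb0).2 ⟨-(g 0)⁻¹ * g 1, ?_⟩)
      rw [mul_smul, eq_neg_of_add_eq_zero_right hg, smul_neg, neg_smul, neg_neg, smul_smul,
        inv_mul_cancel₀ h0, one_smul]
    have h1 : g 1 = 0 := by simpa [h0, hb0] using hg
    exact fun i => by fin_cases i <;> assumption
  have hspan : ∀ (u : Fin 6 → K) (hu : u ≠ 0), Projectivization.mk K u hu ∈ C →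
      ∃ x y z : K, u = x • a + y • b + z • w := by
    have hle : Submodule.span K (Set.range ![a, b, w]) ≤ spanOfSet C := by
      refine Submodule.span_mono ?_
      rintro _ ⟨i, rfl⟩
      fin_cases i
      exacts [⟨ha0, hxa.1⟩, ⟨hb0, hxb.1⟩, ⟨hw0, hxw⟩]
    have heq := Submodule.eq_of_le_of_finrank_le hle (by
      rw [finrank_span_eq_card hindep, Fintype.card_fin]
      omega)
    intro u hu hx
    have hmem : u ∈ spanOfSet C := Submodule.subset_span ⟨hu, hx⟩
    rw [← heq, Submodule.mem_span_range_iff_exists_fun] at hmem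
    obtain ⟨g, rfl⟩ := hmem
    exact ⟨g 0, g 1, g 2, by simp [Fin.sum_univ_three]⟩
  have hpab : plPair a b = 0 := by
    obtain ⟨x, y, z, hc⟩ := hspan c hc0 hxc.1
    have hz : z = 0 := by
      rw [hc, hφlin] at hφc
      exact (mul_eq_zero.1 hφc).resolve_right hxwφ
    subst hz
    have hx : x ≠ 0 := by
      rintro rfl
      exact hbc.symm ((Projectivization.mk_eq_mk_iff' K c b hc0 hb0).2 ⟨y, by simp [hc]⟩)
    have hy : y ≠ 0 := by
      rintro rfl
      exact hac.symm ((Projectivization.mk_eq_mk_iff' K c a hc0 ha0).2 ⟨x, by simp [hc]⟩)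
    have hqc := hquad c hc0 hxc.1
    rw [hc, plQuad_combination, hquad a ha0 hxa.1, hquad b hb0 hxb.1] at hqc
    simpa [hx, hy] using hqc
  obtain ⟨χ, hχ⟩ := exists_plPair_eq_sum w
  have hperp : C ⊆ hyp χ := by
    refine (hCirr.2 _ _ (zClosed_hyp φ) (zClosed_hyp χ) fun x hx => ?_).resolve_left hCφ
    induction x using Projectivization.ind with | h u hu => ?_
    obtain ⟨x, y, z, rfl⟩ := hspan u hu hx
    have hqu := hquad _ hu hx
    rw [plQuad_combination, hquad a ha0 hxa.1, hquad b hb0 hxb.1, hquad w hw0 hxw, hpab] at hqu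
    rw [Set.mem_union, mk_mem_hyp_iff, mk_mem_hyp_iff, ← hχ, hφlin, plPair_combination_left,
      hquad w hw0 hxw]
    have hprod : z * (x * plPair a w + y * plPair b w) = 0 := by linear_combination hqu
    rcases mul_eq_zero.1 hprod with h | h
    · exact Or.inl (by rw [h, zero_mul])
    · exact Or.inr (by rw [h, mul_zero, add_zero])
  have hpaw : plPair a w = 0 := by
    rw [hχ, ← mk_mem_hyp_iff ha0]
    exact hperp hxa.1
  have hpbw : plPair b w = 0 := by
    rw [hχ, ← mk_mem_hyp_iff hb0]
    exact hperp hxb.1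
  rcases concurrent_or_coplanar ha0 (hquad a ha0 hxa.1) (hquad b hb0 hxb.1) (hquad w hw0 hxw)
    hpab hpaw hpbw with ⟨v, hv, hav, hbv, hwv⟩ | ⟨ψ, hψ, haψ, hbψ, hwψ⟩
  · refine hnotsigma (Projectivization.mk K v hv) fun x hx => ⟨hCGr hx, ?_⟩
    induction x using Projectivization.ind with | h u hu => ?_
    obtain ⟨x, y, z, rfl⟩ := hspan u hu hx
    rw [mk_mem_lineOf_iff]
    simp only [join_add_left, join_smul_left, hav, hbv, hwv, smul_zero, add_zero]
  · refine hplane ψ hψ (hS.trans (iUnion_lineOf_eq_hyp hCcl hCinf hψ fun u hu hx => ?_))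
    obtain ⟨x, y, z, rfl⟩ := hspan u hu hx
    simp only [meet_add_left, meet_smul_left, haψ, hbψ, hwψ, smul_zero, add_zero]

end RQS
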